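/- Let B > 0 be a fixed constant and let A be any finite constant with A > B. There exist constants c > 0, d₀ and k₀, depending only on A and B, such that for all d ≥ d₀ and all k ≥ k₀, the stretched maximum-likelihood estimator θ̂⁽ᴬ⁾ (the unique minimizer of the negative log-likelihood ℓ over Θ_A) satisfies sup_{θ* ∈ Θ_B} ‖E[θ̂⁽ᴬ⁾] − θ*‖_∞ ≤ c·(log d + log k)/(d·k). -/

import Mathlib

open Finset

/-- The sigmoid (logistic) function `σ(x) = 1/(1+e^{-x})`. -/
noncomputable def sigmoid (x : ℝ) : ℝ := 1 / (1 + Real.exp (-x))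

/-- Probability that `Binomial(k, p) = w`. -/
noncomputable def binomProb (k : ℕ) (p : ℝ) (w : ℕ) : ℝ :=
  (k.choose w : ℝ) * p ^ w * (1 - p) ^ (k - w)

/-- Sample space for the league format: for each pair `i < j`, the number of wins
of item `i` over item `j` among the `k` comparisons of that pair. -/
abbrev BTLOutcome (d k : ℕ) := {q : Fin d × Fin d // q.1 < q.2} → Fin (k + 1)

/-- Joint probability of an outcome: independent `Binomial(k, σ(θ_i - θ_j))`
win counts across the pairs `i < j`. -/
noncomputable def outcomeProb (d k : ℕ) (θ : Fin d → ℝ) (w : BTLOutcome d k) : ℝ :=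
  ∏ q : {q : Fin d × Fin d // q.1 < q.2},
    binomProb k (sigmoid (θ q.1.1 - θ q.1.2)) (w q : ℕ)

/-- The full win-count matrix `W_ij` determined by an outcome (`W_ji = k - W_ij`). -/
def winCount (d k : ℕ) (w : BTLOutcome d k) (i j : Fin d) : ℕ :=
  if h : i < j then (w ⟨(i, j), h⟩ : ℕ)
  else if h' : j < i then k - (w ⟨(j, i), h'⟩ : ℕ)
  else 0

/-- The observed fraction of wins `μ_ij = W_ij / k`. -/
noncomputable def winFrac (d k : ℕ) (w : BTLOutcome d k) (i j : Fin d) : ℝ :=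
  (winCount d k w i j : ℝ) / (k : ℝ)

/-- The negative log-likelihood
`ℓ(θ) = k ∑_{i<j} [log(e^{θ_i}+e^{θ_j}) - μ_ij θ_i - μ_ji θ_j]`. -/
noncomputable def nll (d k : ℕ) (μ : Fin d → Fin d → ℝ) (θ : Fin d → ℝ) : ℝ :=
  (k : ℝ) * ∑ i : Fin d, ∑ j : Fin d,
    if i < j then
      Real.log (Real.exp (θ i) + Real.exp (θ j)) - μ i j * θ i - μ j i * θ j
    else 0

/-- The parameter domain `Θ_B = {θ : ‖θ‖_∞ ≤ B, ∑ θ_i = 0}`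
(the norm on `Fin d → ℝ` is the sup norm). -/
def paramSet (d : ℕ) (B : ℝ) : Set (Fin d → ℝ) :=
  {θ | ‖θ‖ ≤ B ∧ ∑ i, θ i = 0}

/-- The expectation (under true parameter `θ*`) of an estimator. -/
noncomputable def expVec (d k : ℕ) (θstar : Fin d → ℝ)
    (est : BTLOutcome d k → Fin d → ℝ) : Fin d → ℝ :=
  fun m => ∑ w : BTLOutcome d k, outcomeProb d k θstar w * est w m

theorem sigmoid_eq_real_sigmoid (x : ℝ) : sigmoid x = Real.sigmoid x := by
  simp [sigmoid, Real.sigmoid_def]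

theorem sigmoid_pos (x : ℝ) : 0 < sigmoid x := by
  unfold sigmoid; positivity

theorem sigmoid_neg (x : ℝ) : sigmoid (-x) = 1 - sigmoid x := by
  have h : Real.exp x * Real.exp (-x) = 1 := by rw [← Real.exp_add]; simp
  have h1 := Real.exp_pos x
  have h2 := Real.exp_pos (-x)
  unfold sigmoid
  rw [neg_neg]
  field_simp
  linarith

theorem sigmoid_lt_one (x : ℝ) : sigmoid x < 1 := by
  have := sigmoid_pos (-x)
  rw [sigmoid_neg] at this
  linarith

theorem sigmoid_sub_comm (x y : ℝ) : sigmoid (y - x) = 1 - sigmoid (x - y) := by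
  rw [← sigmoid_neg, neg_sub]

/-- The derivative of the sigmoid function. -/
noncomputable def sigmoidSlope (x : ℝ) : ℝ := sigmoid x * (1 - sigmoid x)

theorem hasDerivAt_sigmoid (x : ℝ) : HasDerivAt sigmoid (sigmoidSlope x) x := by
  have h := Real.hasDerivAt_sigmoid x
  have e : sigmoid = Real.sigmoid := funext sigmoid_eq_real_sigmoid
  unfold sigmoidSlope
  rw [e]
  exact h

theorem sigmoidSlope_nonneg (x : ℝ) : 0 ≤ sigmoidSlope x :=
  mul_nonneg (sigmoid_pos x).le (by linarith [sigmoid_lt_one x])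

theorem sigmoidSlope_le_one (x : ℝ) : sigmoidSlope x ≤ 1 := by
  unfold sigmoidSlope
  nlinarith [sq_nonneg (sigmoid x - 1 / 2)]

theorem exp_neg_div_four_le_sigmoidSlope {x a : ℝ} (hx : |x| ≤ a) :
    Real.exp (-a) / 4 ≤ sigmoidSlope x := by
  have key : ∀ y : ℝ, 0 ≤ y → y ≤ a → Real.exp (-a) / 4 ≤ sigmoidSlope y := by
    intro y hy hya
    have h1 : Real.exp (-a) ≤ Real.exp (-y) := Real.exp_le_exp.2 (by linarith)
    have h2 : Real.exp (-y) ≤ 1 := Real.exp_le_one_iff.2 (by linarith)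
    have h3 := Real.exp_pos (-y)
    have e : sigmoidSlope y = Real.exp (-y) / (1 + Real.exp (-y)) ^ 2 := by
      unfold sigmoidSlope sigmoid
      field_simp
      ring
    rw [e, div_le_div_iff₀ (by norm_num) (by positivity)]
    have h4 : (1 + Real.exp (-y)) ^ 2 ≤ 4 := by nlinarith
    exact mul_le_mul h1 h4 (by positivity) h3.le
  rcases abs_le.1 hx with ⟨h1, h2⟩
  rcases le_total 0 x with h | h
  · exact key x h h2
  · have := key (-x) (by linarith) (by linarith)
    unfold sigmoidSlope at *
    rw [sigmoid_neg] at this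
    linarith

theorem mul_sub_le_sigmoid_sub {a x y : ℝ} (hx : |x| ≤ a) (hy : |y| ≤ a) (hxy : x ≤ y) :
    Real.exp (-a) / 4 * (y - x) ≤ sigmoid y - sigmoid x := by
  refine (convex_Icc (-a) a).mul_sub_le_image_sub_of_le_deriv
    (fun z _ => (hasDerivAt_sigmoid z).continuousAt.continuousWithinAt)
    (fun z _ => (hasDerivAt_sigmoid z).differentiableAt.differentiableWithinAt) ?_
    x (abs_le.1 hx) y (abs_le.1 hy) hxy
  intro z hz
  rw [(hasDerivAt_sigmoid z).deriv]
  exact exp_neg_div_four_le_sigmoidSlope (abs_le.2 (Set.mem_Icc.1 (interior_subset hz)))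

theorem hasDerivAt_sigmoidSlope (x : ℝ) :
    HasDerivAt sigmoidSlope (sigmoidSlope x * (1 - 2 * sigmoid x)) x := by
  have h := (hasDerivAt_sigmoid x).mul ((hasDerivAt_sigmoid x).const_sub 1)
  refine HasDerivAt.congr_deriv (f := sigmoidSlope) h ?_
  ring

theorem abs_sigmoidSlope_sub_le (x y : ℝ) : |sigmoidSlope y - sigmoidSlope x| ≤ |y - x| := by
  have h := convex_univ.norm_image_sub_le_of_norm_hasDerivWithin_le (C := 1)
    (fun z _ => (hasDerivAt_sigmoidSlope z).hasDerivWithinAt) ?_ (Set.mem_univ x) (Set.mem_univ y)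
  · simpa using h
  · intro z _
    rw [Real.norm_eq_abs, abs_mul, abs_of_nonneg (sigmoidSlope_nonneg z)]
    refine mul_le_one₀ (sigmoidSlope_le_one z) (abs_nonneg _) (abs_le.2 ⟨?_, ?_⟩) <;>
      linarith [sigmoid_pos z, sigmoid_lt_one z]

theorem abs_sigmoid_taylor_le (x y : ℝ) :
    |sigmoid y - sigmoid x - sigmoidSlope x * (y - x)| ≤ (y - x) ^ 2 := by
  have h := (convex_uIcc x y).norm_image_sub_le_of_norm_hasDerivWithin_le (C := |y - x|)
    (f := fun t => sigmoid t - sigmoidSlope x * t) (f' := fun t => sigmoidSlope t - sigmoidSlope x)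
    (fun z _ => by
      have h := (hasDerivAt_sigmoid z).sub ((hasDerivAt_id z).const_mul (sigmoidSlope x))
      rw [mul_one] at h
      exact h.hasDerivWithinAt)
    (fun z hz => (abs_sigmoidSlope_sub_le x z).trans (Set.abs_sub_left_of_mem_uIcc hz))
    Set.left_mem_uIcc Set.right_mem_uIcc
  rw [Real.norm_eq_abs, Real.norm_eq_abs, abs_mul_abs_self] at h
  convert h using 1
  · congr 1; ring
  · ring

/-- The difference between the fitted and the observed win fraction of `i` against `j`. -/
noncomputable def winResidual (d k : ℕ) (w : BTLOutcome d k) (θ : Fin d → ℝ) (i j : Fin d) : ℝ :=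
  if i = j then 0 else sigmoid (θ i - θ j) - winFrac d k w i j

/-- The `i`-th coordinate of the gradient of `nll / k`. -/
noncomputable def score (d k : ℕ) (w : BTLOutcome d k) (θ : Fin d → ℝ) (i : Fin d) : ℝ :=
  ∑ j, winResidual d k w θ i j

theorem sum_lt_pair_eq {d : ℕ} (r : Fin d → Fin d → ℝ) (hr : ∀ i, r i i = 0) (v : Fin d → ℝ) :
    ∑ i, ∑ j, (if i < j then r i j * v i + r j i * v j else 0) = ∑ i, v i * ∑ j, r i j := by
  have e1 : ∑ i, ∑ j, (if i < j then r i j * v i + r j i * v j else 0)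
      = ∑ i, ∑ j, (if i < j then r i j * v i else 0)
        + ∑ i, ∑ j, (if i < j then r j i * v j else 0) := by
    rw [← Finset.sum_add_distrib]
    refine Finset.sum_congr rfl fun i _ => ?_
    rw [← Finset.sum_add_distrib]
    refine Finset.sum_congr rfl fun j _ => ?_
    split_ifs <;> simp
  rw [e1, Finset.sum_comm (f := fun i j => if i < j then r j i * v j else 0),
    ← Finset.sum_add_distrib]
  refine Finset.sum_congr rfl fun i _ => ?_
  rw [← Finset.sum_add_distrib, Finset.mul_sum]
  refine Finset.sum_congr rfl fun j _ => ?_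
  rcases lt_trichotomy i j with h | h | h
  · simp [h, h.not_gt, mul_comm]
  · subst h; simp [hr]
  · simp [h, h.not_gt, mul_comm]

theorem winFrac_of_lt {d k : ℕ} (w : BTLOutcome d k) {i j : Fin d} (h : i < j) :
    winFrac d k w i j = ((w ⟨(i, j), h⟩ : ℕ) : ℝ) / k := by
  simp [winFrac, winCount, h]

theorem winFrac_of_gt {d k : ℕ} (hk : 0 < k) (w : BTLOutcome d k) {i j : Fin d} (h : j < i) :
    winFrac d k w i j = 1 - ((w ⟨(j, i), h⟩ : ℕ) : ℝ) / k := by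
  have hw : (w ⟨(j, i), h⟩ : ℕ) ≤ k := Nat.lt_succ_iff.1 (w ⟨(j, i), h⟩).2
  have : (k : ℝ) ≠ 0 := by positivity
  simp only [winFrac, winCount, h, h.not_gt, dite_true, dite_false]
  rw [Nat.cast_sub hw]
  field_simp

theorem winFrac_add_winFrac {d k : ℕ} (hk : 0 < k) (w : BTLOutcome d k) {i j : Fin d}
    (h : i ≠ j) : winFrac d k w i j + winFrac d k w j i = 1 := by
  rcases lt_or_gt_of_ne h with h | h
  · rw [winFrac_of_lt w h, winFrac_of_gt hk w h]; ring
  · rw [winFrac_of_lt w h, winFrac_of_gt hk w h]; ring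

theorem winFrac_nonneg {d k : ℕ} (w : BTLOutcome d k) (i j : Fin d) : 0 ≤ winFrac d k w i j := by
  unfold winFrac; positivity

theorem winResidual_self {d k : ℕ} (w : BTLOutcome d k) (θ : Fin d → ℝ) (i : Fin d) :
    winResidual d k w θ i i = 0 := by simp [winResidual]

theorem winResidual_swap {d k : ℕ} (hk : 0 < k) (w : BTLOutcome d k) (θ : Fin d → ℝ) (i j : Fin d) :
    winResidual d k w θ j i = -winResidual d k w θ i j := by
  by_cases h : i = j
  · subst h; simp [winResidual]
  · have := winFrac_add_winFrac hk w h
    simp only [winResidual, h, Ne.symm h, if_false]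
    rw [sigmoid_sub_comm]
    linarith

theorem abs_winResidual_le_one {d k : ℕ} (hk : 0 < k) (w : BTLOutcome d k) (θ : Fin d → ℝ)
    (i j : Fin d) : |winResidual d k w θ i j| ≤ 1 := by
  by_cases h : i = j
  · simp [winResidual, h]
  · have h1 := winFrac_add_winFrac hk w h
    have h2 := winFrac_nonneg w i j
    have h3 := winFrac_nonneg w j i
    have h4 := sigmoid_pos (θ i - θ j)
    have h5 := sigmoid_lt_one (θ i - θ j)
    simp only [winResidual, h, if_false]
    exact abs_le.2 ⟨by linarith, by linarith⟩

theorem abs_score_le {d k : ℕ} (hk : 0 < k) (w : BTLOutcome d k) (θ : Fin d → ℝ) (i : Fin d) :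
    |score d k w θ i| ≤ d := by
  refine (Finset.abs_sum_le_sum_abs _ _).trans ?_
  refine (Finset.sum_le_sum fun j _ => abs_winResidual_le_one hk w θ i j).trans ?_
  simp

theorem sum_score_eq_zero {d k : ℕ} (hk : 0 < k) (w : BTLOutcome d k) (θ : Fin d → ℝ) :
    ∑ i, score d k w θ i = 0 := by
  have h : ∑ i, score d k w θ i = -∑ i, score d k w θ i := by
    conv_lhs => simp only [score]
    rw [Finset.sum_comm]
    simp only [score, ← Finset.sum_neg_distrib]
    exact Finset.sum_congr rfl fun i _ => Finset.sum_congr rfl fun j _ => winResidual_swap hk w θ i j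
  linarith

theorem score_sub_score {d k : ℕ} (w : BTLOutcome d k) (θ θ' : Fin d → ℝ) (i : Fin d) :
    score d k w θ i - score d k w θ' i
      = ∑ j, (sigmoid (θ i - θ j) - sigmoid (θ' i - θ' j)) := by
  unfold score
  rw [← Finset.sum_sub_distrib]
  refine Finset.sum_congr rfl fun j _ => ?_
  by_cases h : i = j
  · subst h; simp [winResidual]
  · simp [winResidual, h]

theorem hasDerivAt_nll_line {d k : ℕ} (w : BTLOutcome d k) (θ v : Fin d → ℝ) :
    HasDerivAt (fun t : ℝ => nll d k (winFrac d k w) (θ + t • v))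
      (k * ∑ i, v i * score d k w θ i) 0 := by
  unfold score
  rw [← sum_lt_pair_eq _ (winResidual_self w θ)]
  unfold nll
  refine HasDerivAt.const_mul _ (HasDerivAt.fun_sum fun i _ => HasDerivAt.fun_sum fun j _ => ?_)
  by_cases hij : i < j
  · simp only [hij, if_true, winResidual, hij.ne, hij.ne', if_false]
    have hl : ∀ m : Fin d, HasDerivAt (fun t : ℝ => (θ + t • v) m) (v m) 0 := fun m => by
      simpa using ((hasDerivAt_id (0 : ℝ)).mul_const (v m)).const_add (θ m)
    have hpos : Real.exp ((θ + (0 : ℝ) • v) i) + Real.exp ((θ + (0 : ℝ) • v) j) ≠ 0 := by positivity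
    have h := ((((hl i).exp.add (hl j).exp).log hpos).sub
      ((hl i).const_mul (winFrac d k w i j))).sub ((hl j).const_mul (winFrac d k w j i))
    refine HasDerivAt.congr_deriv h ?_
    have hs : ∀ a b : ℝ, sigmoid (a - b) = Real.exp a / (Real.exp a + Real.exp b) := fun a b => by
      unfold sigmoid
      rw [neg_sub, Real.exp_sub]
      field_simp
    have h1 := Real.exp_pos (θ i)
    have h2 := Real.exp_pos (θ j)
    simp only [hs, zero_smul, Pi.add_apply, Pi.zero_apply, add_zero]
    field_simp
    ring
  · simp only [hij, if_false]
    exact hasDerivAt_const _ _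

theorem score_le_score_of_isMin {d k : ℕ} (hk : 0 < k) {w : BTLOutcome d k} {A : ℝ}
    {θ : Fin d → ℝ} (hθ : θ ∈ paramSet d A)
    (hmin : ∀ θ' ∈ paramSet d A, nll d k (winFrac d k w) θ ≤ nll d k (winFrac d k w) θ')
    {a b : Fin d} (ha : θ a < A) (hb : -A < θ b) : score d k w θ b ≤ score d k w θ a := by
  rcases eq_or_ne a b with rfl | hab
  · exact le_rfl
  have h := (hasDerivAt_nll_line w θ (Pi.single a 1 - Pi.single b 1)).tendsto_slope_zero_right
  have hA : 0 ≤ A := (norm_nonneg θ).trans hθ.1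
  have hcoord : ∀ m, |θ m| ≤ A := fun m => (norm_le_pi_norm θ m).trans hθ.1
  have hnonneg : 0 ≤ (k : ℝ) * ∑ i, (Pi.single a 1 - Pi.single b 1 : Fin d → ℝ) i
      * score d k w θ i := by
    refine ge_of_tendsto h ?_
    have hτ : 0 < min (A - θ a) (A + θ b) := lt_min (by linarith) (by linarith)
    filter_upwards [Ioo_mem_nhdsGT hτ] with t ht
    have ht1 := lt_min_iff.1 ht.2
    refine mul_nonneg (inv_nonneg.2 ht.1.le) (sub_nonneg.2 ?_)
    simp only [zero_add, zero_smul, add_zero]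
    refine hmin _ ⟨?_, ?_⟩
    · refine (pi_norm_le_iff_of_nonneg hA).2 fun m => ?_
      have hm := abs_le.1 (hcoord m)
      rw [Real.norm_eq_abs, abs_le]
      rcases eq_or_ne m a with rfl | hma
      · have := ht.1
        simp [hab]
        constructor <;> linarith
      · rcases eq_or_ne m b with rfl | hmb
        · have := ht.1
          simp [hma]
          constructor <;> linarith
        · simpa [hma, hmb] using hm
    · have : ∑ i, (Pi.single a 1 - Pi.single b 1 : Fin d → ℝ) i = 0 := by
        simp [Finset.sum_sub_distrib]
      simp only [Pi.add_apply, Pi.smul_apply, smul_eq_mul, Finset.sum_add_distrib,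
        ← Finset.mul_sum, this, hθ.2]
      simp
  have e : ∑ i, (Pi.single a 1 - Pi.single b 1 : Fin d → ℝ) i * score d k w θ i
      = score d k w θ a - score d k w θ b := by
    simp [sub_mul, Finset.sum_sub_distrib, Pi.single_apply]
  rw [e] at hnonneg
  have : (0 : ℝ) < k := by exact_mod_cast hk
  linarith [nonneg_of_mul_nonneg_right hnonneg this]

theorem abs_sub_le_of_mem_paramSet {d : ℕ} {A : ℝ} {θ : Fin d → ℝ} (hθ : θ ∈ paramSet d A)
    (i j : Fin d) : |θ i - θ j| ≤ 2 * A := by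
  have h1 := (norm_le_pi_norm θ i).trans hθ.1
  have h2 := (norm_le_pi_norm θ j).trans hθ.1
  rw [Real.norm_eq_abs] at h1 h2
  linarith [abs_sub (θ i) (θ j)]

theorem paramSet_mono {d : ℕ} {B A : ℝ} (h : B ≤ A) : paramSet d B ⊆ paramSet d A :=
  fun _ hθ => ⟨hθ.1.trans h, hθ.2⟩

theorem mul_le_score_sub_of_forall_le {d k : ℕ} (w : BTLOutcome d k) {A : ℝ} {θ θ' : Fin d → ℝ}
    (hθ : θ ∈ paramSet d A) (hθ' : θ' ∈ paramSet d A) {i : Fin d}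
    (hi : ∀ j, θ j - θ' j ≤ θ i - θ' i) :
    Real.exp (-(2 * A)) / 4 * (d * (θ i - θ' i)) ≤ score d k w θ i - score d k w θ' i := by
  have e : Real.exp (-(2 * A)) / 4 * (d * (θ i - θ' i))
      = ∑ j, Real.exp (-(2 * A)) / 4 * ((θ i - θ j) - (θ' i - θ' j)) := by
    rw [← Finset.mul_sum]
    congr 1
    simp only [Finset.sum_sub_distrib, hθ.2, hθ'.2]
    simp
    ring
  rw [e, score_sub_score]
  refine Finset.sum_le_sum fun j _ => ?_
  exact mul_sub_le_sigmoid_sub (abs_sub_le_of_mem_paramSet hθ' i j)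
    (abs_sub_le_of_mem_paramSet hθ i j) (by linarith [hi j])

theorem sub_sub_sub_le_of_abs_score_le {d k : ℕ} (hk : 0 < k) {w : BTLOutcome d k} {A B η : ℝ}
    (hAB : B < A) {θ θ' : Fin d → ℝ} (hθ : θ ∈ paramSet d A) (hθ' : θ' ∈ paramSet d B)
    (hmin : ∀ φ ∈ paramSet d A, nll d k (winFrac d k w) θ ≤ nll d k (winFrac d k w) φ)
    (hη : ∀ i, |score d k w θ' i| ≤ η) (i j : Fin d) :
    Real.exp (-(2 * A)) / 4 * (d * ((θ i - θ' i) - (θ j - θ' j))) ≤ 2 * η := by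
  have hθ'A := paramSet_mono hAB.le hθ'
  have : Nonempty (Fin d) := ⟨i⟩
  obtain ⟨M, hM⟩ := Finite.exists_max fun i => θ i - θ' i
  obtain ⟨m, hm⟩ := Finite.exists_min fun i => θ i - θ' i
  have hsum : ∑ i, (θ i - θ' i) = 0 := by rw [Finset.sum_sub_distrib, hθ.2, hθ'.2, sub_zero]
  have hd : (0 : ℝ) < d := by exact_mod_cast i.pos
  have hγ : 0 < Real.exp (-(2 * A)) / 4 := by positivity
  have hM0 : 0 ≤ θ M - θ' M := by
    by_contra! h
    have : ∑ i, (θ i - θ' i) < ∑ _i : Fin d, (0 : ℝ) :=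
      Finset.sum_lt_sum_of_nonempty ⟨i, mem_univ i⟩ fun a _ => (hM a).trans_lt h
    simp [hsum] at this
  have hm0 : θ m - θ' m ≤ 0 := by
    by_contra! h
    have : ∑ _i : Fin d, (0 : ℝ) < ∑ i, (θ i - θ' i) :=
      Finset.sum_lt_sum_of_nonempty ⟨i, mem_univ i⟩ fun a _ => h.trans_le (hm a)
    simp [hsum] at this
  have hbd : ∀ a, -B ≤ θ' a ∧ θ' a ≤ B := fun a =>
    abs_le.1 ((norm_le_pi_norm θ' a).trans hθ'.1)
  have hsc : score d k w θ M ≤ score d k w θ m :=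
    score_le_score_of_isMin hk hθ hmin (by linarith [hbd m]) (by linarith [hbd M])
  have h1 := mul_le_score_sub_of_forall_le w hθ hθ'A hM
  have h2 : Real.exp (-(2 * A)) / 4 * (d * (θ' m - θ m)) ≤ score d k w θ' m - score d k w θ m :=
    mul_le_score_sub_of_forall_le w hθ'A hθ fun a => by linarith [hm a]
  have h3 := abs_le.1 (hη M)
  have h4 := abs_le.1 (hη m)
  have h5 : Real.exp (-(2 * A)) / 4 * (d * ((θ i - θ' i) - (θ j - θ' j)))
      ≤ Real.exp (-(2 * A)) / 4 * (d * ((θ M - θ' M) - (θ m - θ' m))) :=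
    mul_le_mul_of_nonneg_left
      (mul_le_mul_of_nonneg_left (by linarith [hM i, hm j]) hd.le) hγ.le
  have h6 : Real.exp (-(2 * A)) / 4 * (d * ((θ M - θ' M) - (θ m - θ' m)))
      = Real.exp (-(2 * A)) / 4 * (d * (θ M - θ' M))
        + Real.exp (-(2 * A)) / 4 * (d * (θ' m - θ m)) := by ring
  linarith

theorem score_eq_zero_of_interior {d k : ℕ} (hk : 0 < k) {w : BTLOutcome d k} {A : ℝ}
    {θ : Fin d → ℝ} (hθ : θ ∈ paramSet d A)
    (hmin : ∀ φ ∈ paramSet d A, nll d k (winFrac d k w) θ ≤ nll d k (winFrac d k w) φ)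
    (hint : ∀ i, |θ i| < A) (i : Fin d) : score d k w θ i = 0 := by
  have h : ∀ j, score d k w θ j = score d k w θ i := fun j => le_antisymm
    (score_le_score_of_isMin hk hθ hmin (abs_lt.1 (hint i)).2 (abs_lt.1 (hint j)).1)
    (score_le_score_of_isMin hk hθ hmin (abs_lt.1 (hint j)).2 (abs_lt.1 (hint i)).1)
  have hs := sum_score_eq_zero hk w θ
  simp only [h, Finset.sum_const, Finset.card_univ, Fintype.card_fin, nsmul_eq_mul] at hs
  have hd : (d : ℝ) ≠ 0 := by exact_mod_cast i.pos.ne'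
  exact (mul_eq_zero.1 hs).resolve_left hd

/-- Linearization of the score difference around `θ'`. -/
theorem abs_linearized_score_le {d k : ℕ} (w : BTLOutcome d k) (θ θ' : Fin d → ℝ) (i : Fin d) :
    |∑ j, sigmoidSlope (θ' i - θ' j) * ((θ i - θ' i) - (θ j - θ' j)) + score d k w θ' i|
      ≤ |score d k w θ i| + ∑ j, ((θ i - θ' i) - (θ j - θ' j)) ^ 2 := by
  have e : ∑ j, sigmoidSlope (θ' i - θ' j) * ((θ i - θ' i) - (θ j - θ' j)) + score d k w θ' i
      = score d k w θ i - ∑ j, (sigmoid (θ i - θ j) - sigmoid (θ' i - θ' j)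
          - sigmoidSlope (θ' i - θ' j) * ((θ i - θ j) - (θ' i - θ' j))) := by
    rw [Finset.sum_sub_distrib, ← score_sub_score (k := k) w]
    rw [show ∀ a b c d : ℝ, (a + b = c - (c - b - d)) ↔ a = d from
      fun a b c d => by constructor <;> intro h <;> linarith]
    exact Finset.sum_congr rfl fun j _ => by ring
  rw [e]
  refine (abs_sub _ _).trans (add_le_add_right ?_ _)
  refine (Finset.abs_sum_le_sum_abs _ _).trans (Finset.sum_le_sum fun j _ => ?_)
  refine (abs_sigmoid_taylor_le _ _).trans_eq ?_
  ring

theorem mul_abs_le_of_laplacian {d : ℕ} {γ K : ℝ} (hγ : 0 ≤ γ) {a : Fin d → Fin d → ℝ}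
    (ha : ∀ i j, γ ≤ a i j) {x : Fin d → ℝ} (hx : ∑ i, x i = 0)
    (hK : ∀ i, |∑ j, a i j * (x i - x j)| ≤ K) (i : Fin d) : γ * (d * |x i|) ≤ K := by
  have : Nonempty (Fin d) := ⟨i⟩
  obtain ⟨M, hM⟩ := Finite.exists_max x
  obtain ⟨m, hm⟩ := Finite.exists_min x
  have e : ∀ l, γ * (d * x l) = ∑ j, γ * (x l - x j) := fun l => by
    rw [← Finset.mul_sum, Finset.sum_sub_distrib, hx]
    simp
  have h1 : γ * (d * x M) ≤ K := by
    rw [e]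
    refine le_trans (Finset.sum_le_sum fun j _ => ?_) ((le_abs_self _).trans (hK M))
    exact mul_le_mul_of_nonneg_right (ha M j) (by linarith [hM j])
  have h2 : -K ≤ γ * (d * x m) := by
    rw [e]
    refine le_trans (neg_le_of_abs_le (hK m)) (Finset.sum_le_sum fun j _ => ?_)
    exact mul_le_mul_of_nonpos_right (ha m j) (by linarith [hm j])
  rcases abs_cases (x i) with ⟨h, _⟩ | ⟨h, _⟩ <;> rw [h]
  · refine le_trans ?_ h1
    gcongr
    exact hM i
  · have : γ * (d * x m) ≤ γ * (d * x i) := by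
      gcongr
      exact hm i
    linarith [show γ * (d * -x i) = -(γ * (d * x i)) by ring]

theorem bernoulli_mgf_le {p u : ℝ} (hp0 : 0 ≤ p) (hp1 : p ≤ 1) (hu : |u| ≤ 1) :
    p * Real.exp (u * (1 - p)) + (1 - p) * Real.exp (u * -p) ≤ Real.exp (u ^ 2) := by
  have key : ∀ x : ℝ, |x| ≤ 1 → Real.exp (u * x) ≤ 1 + u * x + u ^ 2 * x ^ 2 := fun x hx => by
    have hux : |u * x| ≤ 1 := by rw [abs_mul]; exact mul_le_one₀ hu (abs_nonneg _) hx
    have h := (abs_le.1 (Real.abs_exp_sub_one_sub_id_le hux)).2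
    linarith [mul_pow u x 2]
  have h1 := key (1 - p) (abs_le.2 ⟨by linarith, by linarith⟩)
  have h2 := key (-p) (abs_le.2 ⟨by linarith, by linarith⟩)
  have h3 := mul_le_mul_of_nonneg_left h1 hp0
  have h4 := mul_le_mul_of_nonneg_left h2 (sub_nonneg.2 hp1)
  have h5 := Real.add_one_le_exp (u ^ 2)
  have h6 : u ^ 2 * (p * (1 - p)) ≤ u ^ 2 * 1 :=
    mul_le_mul_of_nonneg_left (by nlinarith) (sq_nonneg u)
  nlinarith

theorem sum_binomProb (k : ℕ) (p : ℝ) : ∑ v : Fin (k + 1), binomProb k p v = 1 := by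
  rw [Fin.sum_univ_eq_sum_range (binomProb k p)]
  have h := (add_pow p (1 - p) k).symm
  rw [add_sub_cancel, one_pow] at h
  rw [← h]
  exact Finset.sum_congr rfl fun v _ => by unfold binomProb; ring

theorem sum_binomProb_mul (k : ℕ) (p : ℝ) :
    ∑ v : Fin (k + 1), binomProb k p v * (v : ℕ) = k * p := by
  rw [Fin.sum_univ_eq_sum_range (fun v => binomProb k p v * v)]
  have h := congr_arg (Polynomial.eval p) (bernsteinPolynomial.sum_smul ℝ k)
  simp only [bernsteinPolynomial, Polynomial.eval_finsetSum, nsmul_eq_mul, Polynomial.eval_mul,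
    Polynomial.eval_natCast, Polynomial.eval_pow, Polynomial.eval_X, Polynomial.eval_sub,
    Polynomial.eval_one] at h
  rw [← h]
  exact Finset.sum_congr rfl fun v _ => by unfold binomProb; ring

theorem sum_binomProb_mul_exp (k : ℕ) (p u : ℝ) :
    ∑ v : Fin (k + 1), binomProb k p v * Real.exp (u * ((v : ℕ) - k * p))
      = (p * Real.exp (u * (1 - p)) + (1 - p) * Real.exp (u * -p)) ^ k := by
  rw [Fin.sum_univ_eq_sum_range (fun v => binomProb k p v * Real.exp (u * (v - k * p))), add_pow]
  refine Finset.sum_congr rfl fun v hv => ?_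
  have hvk : v ≤ k := Nat.lt_succ_iff.1 (Finset.mem_range.1 hv)
  have e : u * ((v : ℝ) - k * p) = v * (u * (1 - p)) + (k - v : ℕ) * (u * -p) := by
    rw [Nat.cast_sub hvk]; ring
  rw [e, Real.exp_add, Real.exp_nat_mul, Real.exp_nat_mul, mul_pow, mul_pow]
  unfold binomProb
  ring

theorem binomial_mgf_le (k : ℕ) {p u : ℝ} (hp0 : 0 ≤ p) (hp1 : p ≤ 1) (hu : |u| ≤ 1) :
    ∑ v : Fin (k + 1), binomProb k p v * Real.exp (u * ((v : ℕ) - k * p))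
      ≤ Real.exp (k * u ^ 2) := by
  rw [sum_binomProb_mul_exp, Real.exp_nat_mul]
  have : 0 ≤ 1 - p := sub_nonneg.2 hp1
  exact pow_le_pow_left₀ (by positivity) (bernoulli_mgf_le hp0 hp1 hu) k

/-- The expectation of a real statistic of the outcome. -/
noncomputable def outcomeExpect (d k : ℕ) (θ : Fin d → ℝ) (f : BTLOutcome d k → ℝ) : ℝ :=
  ∑ w, outcomeProb d k θ w * f w

theorem outcomeProb_nonneg {d k : ℕ} (θ : Fin d → ℝ) (w : BTLOutcome d k) :
    0 ≤ outcomeProb d k θ w := by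
  refine Finset.prod_nonneg fun q _ => ?_
  have h1 := (sigmoid_pos (θ q.1.1 - θ q.1.2)).le
  have h2 := sub_nonneg.2 (sigmoid_lt_one (θ q.1.1 - θ q.1.2)).le
  unfold binomProb
  positivity

theorem outcomeExpect_prod {d k : ℕ} (θ : Fin d → ℝ)
    (f : {q : Fin d × Fin d // q.1 < q.2} → Fin (k + 1) → ℝ) :
    outcomeExpect d k θ (fun w => ∏ q, f q (w q))
      = ∏ q : {q : Fin d × Fin d // q.1 < q.2},
          ∑ v : Fin (k + 1), binomProb k (sigmoid (θ q.1.1 - θ q.1.2)) v * f q v := by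
  rw [Finset.prod_univ_sum, Fintype.piFinset_univ]
  unfold outcomeExpect outcomeProb
  simp only [Finset.prod_mul_distrib]

theorem outcomeExpect_const {d k : ℕ} (θ : Fin d → ℝ) (c : ℝ) : outcomeExpect d k θ (fun _ => c) = c := by
  have h := outcomeExpect_prod (k := k) θ (fun _ _ => 1)
  simp only [mul_one, sum_binomProb, Finset.prod_const_one] at h
  unfold outcomeExpect at *
  simp only [mul_one] at h
  rw [← Finset.sum_mul, h, one_mul]

theorem outcomeExpect_sum {d k : ℕ} (θ : Fin d → ℝ) {ι : Type*} (s : Finset ι)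
    (f : ι → BTLOutcome d k → ℝ) :
    outcomeExpect d k θ (fun w => ∑ i ∈ s, f i w) = ∑ i ∈ s, outcomeExpect d k θ (f i) := by
  unfold outcomeExpect
  simp only [Finset.mul_sum]
  exact Finset.sum_comm

theorem outcomeExpect_add {d k : ℕ} (θ : Fin d → ℝ) (f g : BTLOutcome d k → ℝ) :
    outcomeExpect d k θ (fun w => f w + g w) = outcomeExpect d k θ f + outcomeExpect d k θ g := by
  simp only [outcomeExpect, mul_add, Finset.sum_add_distrib]

theorem outcomeExpect_sub {d k : ℕ} (θ : Fin d → ℝ) (f g : BTLOutcome d k → ℝ) :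
    outcomeExpect d k θ (fun w => f w - g w) = outcomeExpect d k θ f - outcomeExpect d k θ g := by
  simp only [outcomeExpect, mul_sub, Finset.sum_sub_distrib]

theorem outcomeExpect_const_mul {d k : ℕ} (θ : Fin d → ℝ) (c : ℝ) (f : BTLOutcome d k → ℝ) :
    outcomeExpect d k θ (fun w => c * f w) = c * outcomeExpect d k θ f := by
  simp only [outcomeExpect, Finset.mul_sum, mul_left_comm c]

theorem outcomeExpect_mono {d k : ℕ} (θ : Fin d → ℝ) {f g : BTLOutcome d k → ℝ} (h : ∀ w, f w ≤ g w) :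
    outcomeExpect d k θ f ≤ outcomeExpect d k θ g :=
  Finset.sum_le_sum fun w _ => mul_le_mul_of_nonneg_left (h w) (outcomeProb_nonneg θ w)

theorem abs_outcomeExpect_le {d k : ℕ} (θ : Fin d → ℝ) (f : BTLOutcome d k → ℝ) :
    |outcomeExpect d k θ f| ≤ outcomeExpect d k θ (fun w => |f w|) := by
  refine (Finset.abs_sum_le_sum_abs _ _).trans_eq (Finset.sum_congr rfl fun w _ => ?_)
  rw [abs_mul, abs_of_nonneg (outcomeProb_nonneg θ w)]

theorem outcomeExpect_coord {d k : ℕ} (θ : Fin d → ℝ) (q : {q : Fin d × Fin d // q.1 < q.2}) :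
    outcomeExpect d k θ (fun w => ((w q : ℕ) : ℝ)) = k * sigmoid (θ q.1.1 - θ q.1.2) := by
  have h := outcomeExpect_prod (k := k) θ (fun q' v => if q' = q then ((v : ℕ) : ℝ) else 1)
  simp only [Finset.prod_ite_eq', mem_univ, if_true] at h
  rw [h, Finset.prod_eq_single q]
  · simp only [if_true, sum_binomProb_mul]
  · intro q' _ hq'
    simp only [hq', if_false, mul_one, sum_binomProb]
  · simp

theorem outcomeExpect_winFrac {d k : ℕ} (hk : 0 < k) (θ : Fin d → ℝ) {i j : Fin d} (h : i ≠ j) :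
    outcomeExpect d k θ (fun w => winFrac d k w i j) = sigmoid (θ i - θ j) := by
  have key : ∀ {a b : Fin d}, a < b →
      outcomeExpect d k θ (fun w => winFrac d k w a b) = sigmoid (θ a - θ b) := by
    intro a b hab
    have hk' : (k : ℝ) ≠ 0 := by positivity
    simp only [winFrac_of_lt _ hab, div_eq_inv_mul, outcomeExpect_const_mul,
      outcomeExpect_coord θ ⟨(a, b), hab⟩]
    field_simp
  rcases lt_or_gt_of_ne h with hij | hij
  · exact key hij
  · have e : ∀ w : BTLOutcome d k, winFrac d k w i j = 1 - winFrac d k w j i := fun w => by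
      linarith [winFrac_add_winFrac hk w h]
    simp only [e, outcomeExpect_sub, outcomeExpect_const, key hij]
    rw [sigmoid_sub_comm, sub_sub_cancel]

theorem outcomeExpect_score {d k : ℕ} (hk : 0 < k) (θ : Fin d → ℝ) (i : Fin d) :
    outcomeExpect d k θ (fun w => score d k w θ i) = 0 := by
  unfold score
  rw [outcomeExpect_sum]
  refine Finset.sum_eq_zero fun j _ => ?_
  by_cases h : i = j
  · simp [winResidual, h, outcomeExpect_const]
  · simp [winResidual, h, outcomeExpect_sub, outcomeExpect_const, outcomeExpect_winFrac hk θ h]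

theorem sum_pairs_eq {d : ℕ} (F : Fin d → Fin d → ℝ) :
    ∑ q : {q : Fin d × Fin d // q.1 < q.2}, F q.1.1 q.1.2
      = ∑ i, ∑ j, if i < j then F i j else 0 := by
  rw [← Finset.sum_subtype (Finset.univ.filter fun q : Fin d × Fin d => q.1 < q.2) (by simp)
    (fun q => F q.1 q.2), Finset.sum_filter, Fintype.sum_prod_type]

theorem score_eq_sum_pairs {d k : ℕ} (hk : 0 < k) (w : BTLOutcome d k) (θ : Fin d → ℝ)
    (i : Fin d) :
    k * score d k w θ i = ∑ q : {q : Fin d × Fin d // q.1 < q.2},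
      -((Pi.single i 1 : Fin d → ℝ) q.1.1 - (Pi.single i 1 : Fin d → ℝ) q.1.2)
        * ((w q : ℕ) - k * sigmoid (θ q.1.1 - θ q.1.2)) := by
  have h := sum_lt_pair_eq _ (winResidual_self w θ) (Pi.single i 1)
  rw [← sum_pairs_eq (fun a b => winResidual d k w θ a b * (Pi.single i 1 : Fin d → ℝ) a
    + winResidual d k w θ b a * (Pi.single i 1 : Fin d → ℝ) b)] at h
  have e : score d k w θ i = ∑ a, (Pi.single i 1 : Fin d → ℝ) a * ∑ j, winResidual d k w θ a j := by
    simp [Pi.single_apply, score]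
  rw [e, ← h, Finset.mul_sum]
  refine Finset.sum_congr rfl fun q _ => ?_
  have hk' : (k : ℝ) ≠ 0 := by positivity
  rw [winResidual_swap hk w θ q.1.1 q.1.2]
  simp only [winResidual, q.2.ne, if_false, winFrac_of_lt w q.2]
  field_simp
  ring

theorem sum_pairs_sq_le {d : ℕ} (i : Fin d) :
    ∑ q : {q : Fin d × Fin d // q.1 < q.2},
      ((Pi.single i 1 : Fin d → ℝ) q.1.1 - (Pi.single i 1 : Fin d → ℝ) q.1.2) ^ 2 ≤ d := by
  have h := sum_lt_pair_eq (fun a b : Fin d => if a = b then (0 : ℝ) else 1) (by simp)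
    (Pi.single i 1)
  rw [sum_pairs_eq (fun a b => ((Pi.single i 1 : Fin d → ℝ) a - (Pi.single i 1 : Fin d → ℝ) b) ^ 2)]
  calc _ ≤ _ := Finset.sum_le_sum fun a _ => Finset.sum_le_sum fun b _ => ?_
    _ = _ := h
    _ ≤ d := ?_
  · by_cases hab : a < b
    · simp only [hab, if_true, hab.ne, hab.ne', if_false, Pi.single_apply]
      split_ifs <;> norm_num
    · simp [hab]
  · simp only [Pi.single_apply, ite_mul, one_mul, zero_mul, Finset.sum_ite_eq', mem_univ, if_true]
    refine (Finset.sum_le_sum (g := fun _ => (1 : ℝ)) fun j _ => ?_).trans ?_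
    · split_ifs <;> norm_num
    · simp

theorem outcomeExpect_exp_score_le {d k : ℕ} (hk : 0 < k) (θ : Fin d → ℝ) (i : Fin d) {u : ℝ}
    (hu : |u| ≤ 1) :
    outcomeExpect d k θ (fun w => Real.exp (u * (k * score d k w θ i))) ≤ Real.exp (k * u ^ 2 * d) := by
  simp only [score_eq_sum_pairs hk, Finset.mul_sum, Real.exp_sum, ← mul_assoc]
  rw [outcomeExpect_prod θ (fun q v => Real.exp (u
    * -((Pi.single i 1 : Fin d → ℝ) q.1.1 - (Pi.single i 1 : Fin d → ℝ) q.1.2)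
        * ((v : ℕ) - k * sigmoid (θ q.1.1 - θ q.1.2))))]
  have hs : ∀ a b : Fin d,
      |(Pi.single i 1 : Fin d → ℝ) a - (Pi.single i 1 : Fin d → ℝ) b| ≤ 1 := fun a b => by
    simp only [Pi.single_apply]
    split_ifs <;> norm_num
  calc _ ≤ ∏ q : {q : Fin d × Fin d // q.1 < q.2}, Real.exp (k * (u
        * -((Pi.single i 1 : Fin d → ℝ) q.1.1 - (Pi.single i 1 : Fin d → ℝ) q.1.2)) ^ 2) := by
        refine Finset.prod_le_prod (fun q _ => Finset.sum_nonneg fun v _ => ?_) fun q _ => ?_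
        · have h1 := (sigmoid_pos (θ q.1.1 - θ q.1.2)).le
          have h2 := sub_nonneg.2 (sigmoid_lt_one (θ q.1.1 - θ q.1.2)).le
          unfold binomProb
          positivity
        · refine binomial_mgf_le k (sigmoid_pos _).le (sigmoid_lt_one _).le ?_
          rw [abs_mul, abs_neg]
          exact mul_le_one₀ hu (abs_nonneg _) (hs _ _)
    _ ≤ _ := by
        rw [← Real.exp_sum]
        refine Real.exp_le_exp.2 ?_
        simp only [mul_pow, neg_sq, ← mul_assoc]
        rw [← Finset.mul_sum]
        exact mul_le_mul_of_nonneg_left (sum_pairs_sq_le i) (by positivity)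

/-- A Chernoff-type majorant of the indicator of `∃ i, ε * d < |score d k w θ i|`. -/
noncomputable def scoreTail (d k : ℕ) (ε : ℝ) (θ : Fin d → ℝ) (w : BTLOutcome d k) : ℝ :=
  ∑ i, Real.exp (-(k * d * ε ^ 2 / 2)) *
    (Real.exp (ε / 2 * (k * score d k w θ i)) + Real.exp (-(ε / 2) * (k * score d k w θ i)))

theorem scoreTail_nonneg {d k : ℕ} (ε : ℝ) (θ : Fin d → ℝ) (w : BTLOutcome d k) :
    0 ≤ scoreTail d k ε θ w := by
  unfold scoreTail; positivity

theorem one_le_scoreTail {d k : ℕ} {ε : ℝ} (hε : 0 < ε) {θ : Fin d → ℝ} {w : BTLOutcome d k}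
    {i : Fin d} (h : ε * d < |score d k w θ i|) : 1 ≤ scoreTail d k ε θ w := by
  unfold scoreTail
  refine le_trans ?_ (Finset.single_le_sum (fun j _ => by positivity) (mem_univ i))
  have key : 1 ≤ Real.exp (-(k * d * ε ^ 2 / 2)) *
      Real.exp (ε / 2 * (k * |score d k w θ i|)) := by
    rw [← Real.exp_add, Real.one_le_exp_iff]
    have := mul_le_mul_of_nonneg_left h.le (by positivity : 0 ≤ ε / 2 * (k : ℝ))
    linarith
  refine key.trans (mul_le_mul_of_nonneg_left ?_ (Real.exp_pos _).le)
  rcases abs_choice (score d k w θ i) with e | e <;> rw [e]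
  · exact le_add_of_nonneg_right (Real.exp_pos _).le
  · rw [show ε / 2 * (k * -score d k w θ i) = -(ε / 2) * (k * score d k w θ i) by ring]
    exact le_add_of_nonneg_left (Real.exp_pos _).le

theorem outcomeExpect_scoreTail_le {d k : ℕ} (hk : 0 < k) {ε : ℝ} (hε0 : 0 ≤ ε) (hε : ε ≤ 2)
    (θ : Fin d → ℝ) :
    outcomeExpect d k θ (scoreTail d k ε θ) ≤ 2 * d * Real.exp (-(k * d * ε ^ 2 / 4)) := by
  unfold scoreTail
  rw [outcomeExpect_sum]
  have h : ∀ i ∈ (univ : Finset (Fin d)), outcomeExpect d k θ (fun w =>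
      Real.exp (-(k * d * ε ^ 2 / 2)) * (Real.exp (ε / 2 * (k * score d k w θ i))
        + Real.exp (-(ε / 2) * (k * score d k w θ i)))) ≤ 2 * Real.exp (-(k * d * ε ^ 2 / 4)) := by
    intro i _
    rw [outcomeExpect_const_mul, outcomeExpect_add]
    have hu : |ε / 2| ≤ 1 := abs_le.2 ⟨by linarith, by linarith⟩
    have h1 := outcomeExpect_exp_score_le hk θ i hu
    have h2 := outcomeExpect_exp_score_le hk θ i ((abs_neg (ε / 2)).trans_le hu)
    rw [neg_sq] at h2
    refine (mul_le_mul_of_nonneg_left (add_le_add h1 h2) (Real.exp_pos _).le).trans_eq ?_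
    rw [← two_mul, mul_left_comm, ← Real.exp_add]
    congr 2
    ring
  refine (Finset.sum_le_sum h).trans_eq ?_
  simp
  ring

theorem abs_linearized_score_le_scoreTail {d k : ℕ} (hk : 0 < k) {A B ε : ℝ} (hAB : B < A)
    (hε : 0 < ε) (hεAB : 2 * ε < Real.exp (-(2 * A)) / 4 * (A - B)) {θ θ' : Fin d → ℝ}
    (hθ : θ ∈ paramSet d A) (hθ' : θ' ∈ paramSet d B) {w : BTLOutcome d k}
    (hmin : ∀ φ ∈ paramSet d A, nll d k (winFrac d k w) θ ≤ nll d k (winFrac d k w) φ)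
    (i : Fin d) :
    |∑ j, sigmoidSlope (θ' i - θ' j) * ((θ i - θ' i) - (θ j - θ' j)) + score d k w θ' i|
      ≤ d * (4 * ε ^ 2 / (Real.exp (-(2 * A)) / 4) ^ 2
          + (1 + 16 * A ^ 2) * scoreTail d k ε θ' w) := by
  set γ := Real.exp (-(2 * A)) / 4 with hγdef
  have hγ : 0 < γ := by positivity
  have hd : (0 : ℝ) < d := by exact_mod_cast i.pos
  have hP := scoreTail_nonneg ε θ' w
  refine (abs_linearized_score_le w θ θ' i).trans ?_
  by_cases hgood : ∀ l, |score d k w θ' l| ≤ ε * d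
  · have hspread : ∀ a b, (θ a - θ' a) - (θ b - θ' b) ≤ 2 * ε / γ := fun a b => by
      have h := sub_sub_sub_le_of_abs_score_le hk hAB hθ hθ' hmin hgood a b
      rw [← hγdef] at h
      rw [le_div_iff₀ hγ]
      refine le_of_mul_le_mul_right ?_ hd
      linarith
    have hsum : ∑ l, (θ l - θ' l) = 0 := by rw [Finset.sum_sub_distrib, hθ.2, hθ'.2, sub_zero]
    have hε' : 2 * ε / γ < A - B := by rw [div_lt_iff₀ hγ]; linarith
    have hup : ∀ a, θ a - θ' a ≤ 2 * ε / γ := fun a => by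
      have h := Finset.sum_le_sum fun b (_ : b ∈ univ) => hspread a b
      rw [Finset.sum_sub_distrib, hsum] at h
      simp only [Finset.sum_const, Finset.card_univ, Fintype.card_fin, nsmul_eq_mul, sub_zero] at h
      exact le_of_mul_le_mul_left h hd
    have hlo : ∀ b, -(2 * ε / γ) ≤ θ b - θ' b := fun b => by
      have h := Finset.sum_le_sum fun a (_ : a ∈ univ) => hspread a b
      rw [Finset.sum_sub_distrib, hsum] at h
      simp only [Finset.sum_const, Finset.card_univ, Fintype.card_fin, nsmul_eq_mul, zero_sub,
        ← mul_neg] at h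
      linarith [le_of_mul_le_mul_left h hd]
    have hint : ∀ a, |θ a| < A := fun a => by
      have h := abs_le.1 ((norm_le_pi_norm θ' a).trans hθ'.1)
      exact abs_lt.2 ⟨by linarith [hlo a], by linarith [hup a]⟩
    rw [score_eq_zero_of_interior hk hθ hmin hint i, abs_zero, zero_add]
    have hsq : ∀ j ∈ (univ : Finset (Fin d)),
        ((θ i - θ' i) - (θ j - θ' j)) ^ 2 ≤ 4 * ε ^ 2 / γ ^ 2 := fun j _ => by
      rw [show 4 * ε ^ 2 / γ ^ 2 = (2 * ε / γ) ^ 2 by ring]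
      exact sq_le_sq' (by linarith [hspread j i]) (hspread i j)
    refine (Finset.sum_le_sum hsq).trans ?_
    simp only [Finset.sum_const, Finset.card_univ, Fintype.card_fin, nsmul_eq_mul]
    refine mul_le_mul_of_nonneg_left (le_add_of_nonneg_right (by positivity)) hd.le
  · push Not at hgood
    obtain ⟨l, hl⟩ := hgood
    have h1 := one_le_scoreTail hε hl
    have hθ'A := paramSet_mono hAB.le hθ'
    have hsq : ∀ j ∈ (univ : Finset (Fin d)),
        ((θ i - θ' i) - (θ j - θ' j)) ^ 2 ≤ 16 * A ^ 2 := fun j _ => by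
      have ha := abs_le.1 (abs_sub_le_of_mem_paramSet hθ i j)
      have hb := abs_le.1 (abs_sub_le_of_mem_paramSet hθ'A i j)
      rw [show 16 * A ^ 2 = (4 * A) ^ 2 by ring]
      exact sq_le_sq' (by linarith) (by linarith)
    have h2 := Finset.sum_le_sum hsq
    simp only [Finset.sum_const, Finset.card_univ, Fintype.card_fin, nsmul_eq_mul] at h2
    have h3 := abs_score_le hk w θ i
    have h4 : (1 + 16 * A ^ 2) * 1 ≤ (1 + 16 * A ^ 2) * scoreTail d k ε θ' w :=
      mul_le_mul_of_nonneg_left h1 (by positivity)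
    have h5 : 0 ≤ 4 * ε ^ 2 / γ ^ 2 := by positivity
    calc _ ≤ (d : ℝ) * ((1 + 16 * A ^ 2) * 1) := by linarith
      _ ≤ _ := mul_le_mul_of_nonneg_left (by linarith) hd.le

theorem mul_abs_bias_le {d k : ℕ} (hk : 0 < k) {A B ε : ℝ} (hAB : B < A)
    (hε : 0 < ε) (hε2 : ε ≤ 2) (hεAB : 2 * ε < Real.exp (-(2 * A)) / 4 * (A - B))
    {mle : BTLOutcome d k → Fin d → ℝ}
    (hmle : ∀ w, mle w ∈ paramSet d A ∧
      ∀ θ ∈ paramSet d A, nll d k (winFrac d k w) (mle w) ≤ nll d k (winFrac d k w) θ)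
    {θ' : Fin d → ℝ} (hθ' : θ' ∈ paramSet d B) (i : Fin d) :
    Real.exp (-(2 * A)) / 4 * |expVec d k θ' mle i - θ' i|
      ≤ 4 * ε ^ 2 / (Real.exp (-(2 * A)) / 4) ^ 2
        + (1 + 16 * A ^ 2) * (2 * d * Real.exp (-(k * d * ε ^ 2 / 4))) := by
  have hd : (0 : ℝ) < d := by exact_mod_cast i.pos
  have hθ'A := paramSet_mono hAB.le hθ'
  have hΔ : ∀ a, expVec d k θ' mle a - θ' a
      = outcomeExpect d k θ' (fun w => mle w a - θ' a) := fun a => by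
    rw [outcomeExpect_sub, outcomeExpect_const]
    rfl
  have hsum : ∑ a, (expVec d k θ' mle a - θ' a) = 0 := by
    simp only [hΔ]
    rw [← outcomeExpect_sum]
    simp only [Finset.sum_sub_distrib, (hmle _).1.2, hθ'.2, sub_zero, outcomeExpect_const]
  have h := mul_abs_le_of_laplacian (by positivity)
    (fun a b => exp_neg_div_four_le_sigmoidSlope (abs_sub_le_of_mem_paramSet hθ'A a b)) hsum
    (K := d * (4 * ε ^ 2 / (Real.exp (-(2 * A)) / 4) ^ 2
        + (1 + 16 * A ^ 2) * (2 * d * Real.exp (-(k * d * ε ^ 2 / 4))))) ?_ i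
  · refine le_of_mul_le_mul_left ?_ hd
    linarith
  intro a
  have e : ∑ j, sigmoidSlope (θ' a - θ' j)
        * ((expVec d k θ' mle a - θ' a) - (expVec d k θ' mle j - θ' j))
      = outcomeExpect d k θ' (fun w => ∑ j, sigmoidSlope (θ' a - θ' j)
        * ((mle w a - θ' a) - (mle w j - θ' j)) + score d k w θ' a) := by
    rw [outcomeExpect_add, outcomeExpect_score hk, add_zero, outcomeExpect_sum]
    simp only [outcomeExpect_const_mul, hΔ]
    exact Finset.sum_congr rfl fun j _ => by rw [← outcomeExpect_sub]
  rw [e]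
  refine (abs_outcomeExpect_le _ _).trans ((outcomeExpect_mono θ' fun w =>
    abs_linearized_score_le_scoreTail hk hAB hε hεAB (hmle w).1 hθ' (hmle w).2 a).trans ?_)
  rw [outcomeExpect_const_mul, outcomeExpect_add, outcomeExpect_const, outcomeExpect_const_mul]
  refine mul_le_mul_of_nonneg_left (add_le_add le_rfl ?_) hd.le
  exact mul_le_mul_of_nonneg_left (outcomeExpect_scoreTail_le hk hε.le hε2 θ') (by positivity)

/-- Theorem 1(b): for any constants `A > B > 0`, the stretched
MLE (minimizer of the negative log-likelihood over `Θ_A`) has bias upper bounded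
as `sup_{θ* ∈ Θ_B} ‖E[θ̂⁽ᴬ⁾] − θ*‖_∞ ≤ c (log d + log k)/(dk)` for all `d ≥ d₀`,
`k ≥ k₀`, with constants `c, d₀, k₀` depending only on `A` and `B`. -/
theorem stretched_mle_bias_upper_bound (B A : ℝ) (hB : 0 < B) (hAB : B < A) :
    ∃ c > (0 : ℝ), ∃ d₀ k₀ : ℕ, ∀ d k : ℕ, d₀ ≤ d → k₀ ≤ k →
      ∀ mle : BTLOutcome d k → Fin d → ℝ,
        (∀ w : BTLOutcome d k,
          mle w ∈ paramSet d A ∧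
            ∀ θ ∈ paramSet d A,
              nll d k (winFrac d k w) (mle w) ≤ nll d k (winFrac d k w) θ) →
        ∀ θstar ∈ paramSet d B,
          ‖expVec d k θstar mle - θstar‖ ≤
            c * (Real.log d + Real.log k) / ((d : ℝ) * k) := by
  have hAB' : 0 < A - B := sub_pos.2 hAB
  set γ := Real.exp (-(2 * A)) / 4 with hγdef
  have hγ : 0 < γ := by positivity
  have hη : 0 < (min 2 (γ * (A - B) / 4)) ^ 2 / 8 := by positivity
  obtain ⟨N, hN⟩ := Filter.eventually_atTop.1
    ((Real.isLittleO_log_id_atTop.def hη).and (Filter.eventually_ge_atTop (3 : ℝ)))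
  refine ⟨(32 / γ ^ 2 + (1 + 16 * A ^ 2) * 2) / γ, by positivity, max 1 ⌈N⌉₊, 1, ?_⟩
  intro d k hd hk mle hmle θstar hθstar
  have hd1 : (1 : ℝ) ≤ d := by exact_mod_cast (le_max_left _ _).trans hd
  have hk1 : (1 : ℝ) ≤ k := by exact_mod_cast hk
  have hdN : N ≤ d := (Nat.le_ceil N).trans (by exact_mod_cast (le_max_right _ _).trans hd)
  set n : ℝ := d * k with hn
  have hnd : (d : ℝ) ≤ n := le_mul_of_one_le_right (by linarith) hk1
  obtain ⟨hlog, hn3⟩ := hN n (hdN.trans hnd)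
  have hn0 : 0 < n := by linarith
  have hlog1 : 1 ≤ Real.log n := by
    rw [Real.le_log_iff_exp_le hn0]
    linarith [Real.exp_one_lt_d9]
  rw [Real.norm_of_nonneg (by linarith), id, Real.norm_of_nonneg hn0.le] at hlog
  rw [← Real.log_mul (by positivity) (by positivity), ← hn]
  set ε := Real.sqrt (8 * (Real.log n / n)) with hεdef
  have hL : 0 < Real.log n / n := by positivity
  have hε : 0 < ε := Real.sqrt_pos.2 (by positivity)
  have hεsq : ε ^ 2 = 8 * (Real.log n / n) := Real.sq_sqrt (by positivity)
  have hεle : ε ≤ min 2 (γ * (A - B) / 4) := by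
    refine Real.sqrt_le_iff.2 ⟨by positivity, ?_⟩
    have : Real.log n / n ≤ (min 2 (γ * (A - B) / 4)) ^ 2 / 8 := (div_le_iff₀ hn0).2 hlog
    linarith
  have hεAB : 2 * ε < γ * (A - B) := by
    have := hεle.trans (min_le_right _ _)
    have : 0 < γ * (A - B) := by positivity
    linarith
  have htail : 2 * (d : ℝ) * Real.exp (-(k * d * ε ^ 2 / 4)) ≤ 2 * (Real.log n / n) := by
    have e : -(k * d * ε ^ 2 / 4) = -Real.log n + -Real.log n := by
      rw [hεsq, mul_comm (k : ℝ) d, ← hn]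
      field_simp
      ring
    rw [e, Real.exp_add, Real.exp_neg, Real.exp_log hn0, mul_assoc]
    refine mul_le_mul_of_nonneg_left ?_ zero_le_two
    rw [← mul_assoc, ← div_eq_mul_inv]
    refine div_le_div_of_nonneg_right ?_ hn0.le
    rw [← div_eq_mul_inv]
    exact ((div_le_one hn0).2 hnd).trans hlog1
  refine (pi_norm_le_iff_of_nonneg (by positivity)).2 fun i => ?_
  have h := mul_abs_bias_le hk hAB hε (hεle.trans (min_le_left _ _)) hεAB hmle hθstar i
  rw [← hγdef] at h
  have h2 := mul_le_mul_of_nonneg_left htail (by positivity : 0 ≤ 1 + 16 * A ^ 2)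
  rw [hεsq] at h h2
  rw [Real.norm_eq_abs, Pi.sub_apply,
    show (32 / γ ^ 2 + (1 + 16 * A ^ 2) * 2) / γ * Real.log n / n
      = (4 * (8 * (Real.log n / n)) / γ ^ 2 + (1 + 16 * A ^ 2) * (2 * (Real.log n / n))) / γ by ring,
    le_div_iff₀ hγ]
  linarith
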